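/- Every ⊞-closed subclass of the complete pin class P° satisfying the adjacency condition has a proper growth rate: the limit of C_n^{1/n} exists, where C_n is the number of elements of length n. -/

import Mathlib

/-- A *centred permutation*: `vals` is the one-line notation of the filled-in
permutation (length `n+1`), `origin` the index of the origin point. -/
structure CPerm where
  vals : List ℕ
  origin : ℕ
deriving DecidableEq

namespace CPerm

/-- Length of a centred permutation (origin does not count). -/
def len (p : CPerm) : ℕ := p.vals.length - 1

/-- A genuine centred permutation: one-line notation is a permutation of
`{0, …, N-1}` and the origin index is in range. -/
def IsValid (p : CPerm) : Prop :=
  p.vals ≠ [] ∧ p.origin < p.vals.length ∧ p.vals.Perm (List.range p.vals.length)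

def valAt (p : CPerm) (i : ℕ) : ℕ := p.vals.getD i 0

def originVal (p : CPerm) : ℕ := p.valAt p.origin

/-- The box-sum `p ⊞ q`: inflate the origin of `q` by a copy of `p`. -/
def boxSum (p q : CPerm) : CPerm :=
  let N := p.vals.length
  let v := q.originVal
  let shift : ℕ → ℕ := fun u => if u < v then u else u + (N - 1)
  ⟨(q.vals.take q.origin).map shift ++ p.vals.map (· + v) ++
      (q.vals.drop (q.origin + 1)).map shift,
    q.origin + p.origin⟩

/-- The trivial centred permutation (origin only, length 0). -/
def trivial : CPerm := ⟨[0], 0⟩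

/-- Iterated box-sum `σ₁ ⊞ σ₂ ⊞ ⋯ ⊞ σₙ`. -/
def boxSumList (l : List CPerm) : CPerm := l.foldr boxSum trivial

/-- `p` is ⊞-indecomposable: nonempty and not a box-sum of two strictly smaller
centred permutations. -/
def BoxIndecomposable (p : CPerm) : Prop :=
  1 ≤ p.len ∧
    ¬∃ a b : CPerm, a.IsValid ∧ b.IsValid ∧ 1 ≤ a.len ∧ 1 ≤ b.len ∧ boxSum a b = p

/-- The non-origin point at index `i` of `p` lies in quadrant `q` (1–4,
numbered anticlockwise). -/
def InQuadrant (p : CPerm) (q : ℕ) (i : ℕ) : Prop :=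
  i < p.vals.length ∧ i ≠ p.origin ∧
    ((q = 1 ∧ p.origin < i ∧ p.originVal < p.valAt i) ∨
     (q = 2 ∧ i < p.origin ∧ p.originVal < p.valAt i) ∨
     (q = 3 ∧ i < p.origin ∧ p.valAt i < p.originVal) ∨
     (q = 4 ∧ p.origin < i ∧ p.valAt i < p.originVal))

/-- All non-origin points of `p` lie in quadrant `q`. -/
def OneQuadrant (p : CPerm) (q : ℕ) : Prop :=
  ∀ i, i < p.vals.length → i ≠ p.origin → InQuadrant p q i

def OppositeQuadrants (q₁ q₂ : ℕ) : Prop :=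
  (q₁ = 1 ∧ q₂ = 3) ∨ (q₁ = 3 ∧ q₂ = 1) ∨ (q₁ = 2 ∧ q₂ = 4) ∨ (q₁ = 4 ∧ q₂ = 2)

/-- Centred pattern containment `p ≤ q` (origins must match up). -/
def PatternLE (p q : CPerm) : Prop :=
  ∃ f : ℕ → ℕ,
    (∀ i j, i < p.vals.length → j < p.vals.length → i < j → f i < f j) ∧
    (∀ i, i < p.vals.length → f i < q.vals.length) ∧
    f p.origin = q.origin ∧
    (∀ i j, i < p.vals.length → j < p.vals.length →
      (p.valAt i < p.valAt j ↔ q.valAt (f i) < q.valAt (f j)))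

/-- A centred permutation class: nonempty, consisting of valid centred
permutations, and downward closed under centred containment. -/
def IsClass (S : Set CPerm) : Prop :=
  S.Nonempty ∧ (∀ p ∈ S, p.IsValid) ∧
    ∀ p q : CPerm, q ∈ S → p.IsValid → PatternLE p q → p ∈ S

/-- `S` is closed under the box-sum. -/
def BoxClosed (S : Set CPerm) : Prop := ∀ p ∈ S, ∀ q ∈ S, boxSum p q ∈ S

/-- Number of centred permutations of length `n` in `S`. -/
noncomputable def count (S : Set CPerm) (n : ℕ) : ℕ := {p | p ∈ S ∧ p.len = n}.ncard

/-- The single-point centred permutation in quadrant `q`. -/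
def mu : ℕ → CPerm
  | 1 => ⟨[0, 1], 0⟩
  | 2 => ⟨[1, 0], 1⟩
  | 3 => ⟨[0, 1], 1⟩
  | 4 => ⟨[1, 0], 0⟩
  | _ => ⟨[0], 0⟩

def AdjacentQuadrants (a b : ℕ) : Prop :=
  (a, b) = (1, 2) ∨ (a, b) = (2, 3) ∨ (a, b) = (3, 4) ∨ (a, b) = (4, 1) ∨
  (a, b) = (2, 1) ∨ (a, b) = (3, 2) ∨ (a, b) = (4, 3) ∨ (a, b) = (1, 4)

/-- The adjacency condition on a centred class. -/
def AdjacencyCondition (S : Set CPerm) : Prop :=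
  (∃! q : ℕ, q ∈ ({1, 2, 3, 4} : Set ℕ) ∧ mu q ∈ S) ∨
    ∃ a b : ℕ, AdjacentQuadrants a b ∧ mu a ∈ S ∧ mu b ∈ S

end CPerm

inductive PinLetter | u | d | l | r
deriving DecidableEq

def PinLetter.isVert : PinLetter → Bool
  | .u => true
  | .d => true
  | .l => false
  | .r => false

/-- Letters strictly alternate between vertical and horizontal alignment. -/
def PinAlt (ls : List PinLetter) : Prop :=
  List.Chain' (fun a b => a.isVert ≠ b.isVert) ls

/-- A pin word: an initial numeral `q ∈ {1,…,4}` followed by alternating letters. -/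
def IsPinWord (q : ℕ) (ls : List PinLetter) : Prop := 1 ≤ q ∧ q ≤ 4 ∧ PinAlt ls

def firstPt : ℕ → ℚ × ℚ
  | 1 => (1, 1)
  | 2 => (-1, 1)
  | 3 => (-1, -1)
  | 4 => (1, -1)
  | _ => (1, 1)

def maxOf (l : List ℚ) : ℚ := l.foldr max 0
def minOf (l : List ℚ) : ℚ := l.foldr min 0

/-- Place the next pin: beyond the bounding rectangle in the given direction,
separating the previous point from all the others. The list holds the points
newest-first; the origin `(0,0)` is the last entry. -/
def pinStep (pts : List (ℚ × ℚ)) (dir : PinLetter) : List (ℚ × ℚ) :=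
  let last := pts.headD (0, 0)
  let rest := pts.tail
  let btwY : ℚ :=
    if maxOf (rest.map Prod.snd) < last.2 then (last.2 + maxOf (rest.map Prod.snd)) / 2
    else (last.2 + minOf (rest.map Prod.snd)) / 2
  let btwX : ℚ :=
    if maxOf (rest.map Prod.fst) < last.1 then (last.1 + maxOf (rest.map Prod.fst)) / 2
    else (last.1 + minOf (rest.map Prod.fst)) / 2
  let np : ℚ × ℚ :=
    match dir with
    | .r => (maxOf (pts.map Prod.fst) + 1, btwY)
    | .l => (minOf (pts.map Prod.fst) - 1, btwY)
    | .u => (btwX, maxOf (pts.map Prod.snd) + 1)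
    | .d => (btwX, minOf (pts.map Prod.snd) - 1)
  np :: pts

/-- The points (newest first, origin last) drawn from a pin word. -/
def pinPts (q : ℕ) (ls : List PinLetter) : List (ℚ × ℚ) :=
  ls.foldl pinStep [firstPt q, (0, 0)]

/-- Convert a finite set of plane points (with origin `(0,0)`) into a centred
permutation in canonical form. -/
def toCPerm (pts : List (ℚ × ℚ)) : CPerm :=
  ⟨(pts.mergeSort (fun a b => decide (a.1 ≤ b.1))).map
      (fun pt => ((pts.map Prod.snd).filter (fun y => decide (y < pt.2))).length),
    ((pts.map Prod.fst).filter (fun x => decide (x < 0))).length⟩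

/-- The centred pin permutation of a pin word. -/
def pinPerm (q : ℕ) (ls : List PinLetter) : CPerm := toCPerm (pinPts q ls)

/-- The complete pin class `P°`: the downward closure of all box-sums of
centred pin permutations. -/
def CompletePinClass : Set CPerm :=
  {p | p.IsValid ∧
    ∃ ws : List (ℕ × List PinLetter), (∀ w ∈ ws, IsPinWord w.1 w.2) ∧
      CPerm.PatternLE p (CPerm.boxSumList (ws.map fun w => pinPerm w.1 w.2))}

/-- An infinite pin sequence: numeral `q` and letters `f 0, f 1, …`,
alternating in alignment. -/
def IsPinSeq (q : ℕ) (f : ℕ → PinLetter) : Prop :=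
  1 ≤ q ∧ q ≤ 4 ∧ ∀ n, (f n).isVert ≠ (f (n + 1)).isVert

def seqPrefix (f : ℕ → PinLetter) (n : ℕ) : List PinLetter := (List.range n).map f

/-- The pin class of an infinite pin sequence. -/
def PinClassOf (q : ℕ) (f : ℕ → PinLetter) : Set CPerm :=
  {p | p.IsValid ∧ ∃ n : ℕ, CPerm.PatternLE p (pinPerm q (seqPrefix f n))}

/-- The `i`-th point (`i ≥ 1`) placed when drawing the pin sequence. -/
def seqPoint (q : ℕ) (f : ℕ → PinLetter) (i : ℕ) : ℚ × ℚ :=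
  (pinPts q (seqPrefix f (i - 1))).headD (0, 0)

/-- The quadrant of a plane point. -/
def quadOf (pt : ℚ × ℚ) : ℕ :=
  if 0 < pt.1 then (if 0 < pt.2 then 1 else 4) else (if 0 < pt.2 then 2 else 3)

/-- The pin word `w` is the pin factor of the sequence starting at position `i ≥ 1`
(first letter replaced by the quadrant of the corresponding point). -/
def FactorAt (q : ℕ) (f : ℕ → PinLetter) (i : ℕ) (w : ℕ × List PinLetter) : Prop :=
  1 ≤ i ∧ w.1 = quadOf (seqPoint q f i) ∧
    ∀ t, t < w.2.length → w.2.getD t PinLetter.u = f (i - 1 + t)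

/-- A recurrent pin factor: one occurring arbitrarily late. -/
def RecurrentFactor (q : ℕ) (f : ℕ → PinLetter) (w : ℕ × List PinLetter) : Prop :=
  ∀ N : ℕ, ∃ i, N ≤ i ∧ FactorAt q f i w

/-- The ⊞-interior of a pin class: the ⊞-closure (as a class) of the
permutations generated by recurrent pin factors. -/
def BoxInterior (q : ℕ) (f : ℕ → PinLetter) : Set CPerm :=
  {p | p.IsValid ∧
    ∃ l : List CPerm,
      (∀ x ∈ l, ∃ w : ℕ × List PinLetter, RecurrentFactor q f w ∧ x = pinPerm w.1 w.2) ∧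
      CPerm.PatternLE p (CPerm.boxSumList l)}

open Filter

namespace CPerm

lemma valid_pos {p : CPerm} (h : p.IsValid) : 0 < p.vals.length :=
  List.length_pos_iff.2 h.1

lemma valAt_eq {p : CPerm} {i : ℕ} (hi : i < p.vals.length) : p.valAt i = p.vals[i] := by
  rw [valAt, List.getD_eq_getElem _ _ hi]

lemma valid_lt {p : CPerm} (h : p.IsValid) {i : ℕ} (hi : i < p.vals.length) :
    p.valAt i < p.vals.length := by
  rw [valAt_eq hi]
  have := (h.2.2.mem_iff (a := p.vals[i])).1 (List.getElem_mem hi)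
  simpa using this

lemma valid_inj {p : CPerm} (h : p.IsValid) {i j : ℕ} (hi : i < p.vals.length)
    (hj : j < p.vals.length) (e : p.valAt i = p.valAt j) : i = j := by
  rw [valAt_eq hi, valAt_eq hj] at e
  have nd : p.vals.Nodup := h.2.2.nodup_iff.2 List.nodup_range
  exact (nd.getElem_inj_iff).1 e

lemma valid_surj {p : CPerm} (h : p.IsValid) {u : ℕ} (hu : u < p.vals.length) :
    ∃ i, i < p.vals.length ∧ p.valAt i = u := by
  have := (h.2.2.mem_iff (a := u)).2 (by simpa using hu)
  obtain ⟨i, hi, e⟩ := List.getElem_of_mem this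
  exact ⟨i, hi, by rw [valAt_eq hi, e]⟩

/-- The insertion shift. -/
def sh (o N u : ℕ) : ℕ := if u < o then u else u + (N - 1)

lemma boxSum_vals (p q : CPerm) : (boxSum p q).vals =
    (q.vals.take q.origin).map (sh q.originVal p.vals.length) ++ p.vals.map (· + q.originVal) ++
      (q.vals.drop (q.origin + 1)).map (sh q.originVal p.vals.length) := rfl

lemma boxSum_origin (p q : CPerm) : (boxSum p q).origin = q.origin + p.origin := rfl

lemma boxSum_length {p q : CPerm} (hq : q.origin < q.vals.length) :
    (boxSum p q).vals.length + 1 = p.vals.length + q.vals.length := by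
  rw [boxSum_vals]
  simp only [List.length_append, List.length_map, List.length_take, List.length_drop]
  omega

lemma boxSum_valAt_block {p q : CPerm} (hq : q.origin < q.vals.length) {j : ℕ}
    (hj : j < p.vals.length) :
    (boxSum p q).valAt (q.origin + j) = p.valAt j + q.originVal := by
  have h1 : (List.map (sh q.originVal p.vals.length) (List.take q.origin q.vals)).length
      = q.origin := by simp; omega
  rw [valAt, boxSum_vals, List.append_assoc, List.getD_append_right _ _ _ _ (by omega), h1,
    List.getD_append _ _ _ _ (by simp; omega), valAt_eq hj, List.getD_eq_getElem _ _ (by simp; omega)]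
  simp

lemma boxSum_valAt_out {p q : CPerm} (hp : 0 < p.vals.length) {i : ℕ}
    (hi : i < q.vals.length) (hq : q.origin < q.vals.length) (hne : i ≠ q.origin) :
    (boxSum p q).valAt (sh q.origin p.vals.length i)
      = sh q.originVal p.vals.length (q.valAt i) := by
  have h1 : (List.map (sh q.originVal p.vals.length) (List.take q.origin q.vals)).length
      = q.origin := by simp; omega
  rw [valAt, boxSum_vals, List.append_assoc]
  by_cases h : i < q.origin
  · rw [sh, if_pos h, List.getD_append _ _ _ _ (by omega),
      List.getD_eq_getElem _ _ (by omega), valAt_eq hi]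
    simp
  · rw [sh, if_neg h, List.getD_append_right _ _ _ _ (by omega), h1,
      List.getD_append_right _ _ _ _ (by simp; omega),
      List.getD_eq_getElem _ _ (by simp; omega), valAt_eq hi]
    simp only [List.getElem_map, List.getElem_drop, List.length_map]
    congr 2
    omega

lemma sh_inj {o N u w : ℕ} (h : sh o N u = sh o N w) : u = w := by
  unfold sh at h; split_ifs at h <;> omega

lemma boxSum_cancel {p q p' q' : CPerm} (hq : q.origin < q.vals.length)
    (hq' : q'.origin < q'.vals.length) (hl : p.vals.length = p'.vals.length)
    (h : boxSum p q = boxSum p' q') (ho : q.origin = q'.origin)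
    (hv : q.originVal = q'.originVal) : p = p' ∧ q = q' := by
  have e1 := congrArg CPerm.vals h
  have e2 := congrArg CPerm.origin h
  rw [boxSum_vals, boxSum_vals] at e1
  rw [boxSum_origin, boxSum_origin] at e2
  rw [← hv, ← hl, ← ho] at e1
  rw [List.append_assoc, List.append_assoc] at e1
  obtain ⟨a1, a2⟩ := List.append_inj e1 (by simp; omega)
  obtain ⟨a2, a3⟩ := List.append_inj a2 (by simp; omega)
  have inj : Function.Injective (sh q.originVal p.vals.length) := fun _ _ => sh_inj
  have b1 := inj.list_map a1
  have b3 := inj.list_map a3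
  have b2 := (add_left_injective q.originVal).list_map a2
  constructor
  · cases p; cases p'; simp only [CPerm.mk.injEq] at *; exact ⟨b2, by omega⟩
  · have : q.vals = q'.vals := by
      rw [← List.take_append_drop q.origin q.vals, ← List.take_append_drop q.origin q'.vals, b1,
        List.drop_eq_getElem_cons hq,
        List.drop_eq_getElem_cons (show q.origin < q'.vals.length by omega), b3]
      congr 2
      have : q.valAt q.origin = q'.valAt q.origin := by
        have h := hv
        unfold originVal at h
        rw [h, ho]
      rwa [valAt_eq hq, valAt_eq (show q.origin < q'.vals.length by omega)] at this
    cases q; cases q'; simp only [CPerm.mk.injEq] at *; exact ⟨this, ho⟩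

end CPerm

/-- comparison in the direction given by a Boolean -/
def bcmp {α : Type*} [LT α] (b : Bool) (x y : α) : Prop := if b then x < y else y < x

/-- the `k`-th term is placed in one of four ways relative to the earlier ones -/
def GoodAt {α : Type*} [LT α] (a : ℕ → α) (k : ℕ) (b : Bool × Bool) : Prop :=
  (∀ j, j + 1 < k → bcmp b.1 (a j) (a k)) ∧ (∀ j, j + 1 = k → bcmp b.2 (a j) (a k))

def GoodSeq {α : Type*} [LT α] (N : ℕ) (a : ℕ → α) : Prop := ∀ k < N, ∃ b, GoodAt a k b

lemma bcmp_iff {α β : Type*} [LT α] [LT β] {x y : α} {z w : β} (h : x < y ↔ z < w)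
    (h' : y < x ↔ w < z) (b : Bool) : bcmp b x y ↔ bcmp b z w := by
  cases b <;> simp [bcmp, h, h']

lemma bcmp_ne {α : Type*} [Preorder α] {x y : α} {b : Bool} (h : bcmp b x y) : x ≠ y := by
  cases b <;> simp [bcmp] at h
  · exact h.ne'
  · exact h.ne

lemma GoodSeq.ne {α : Type*} [Preorder α] {N : ℕ} {a : ℕ → α} (h : GoodSeq N a) {j k : ℕ}
    (hjk : j < k) (hk : k < N) : a j ≠ a k := by
  obtain ⟨b, h1, h2⟩ := h k hk
  rcases Nat.lt_or_ge (j + 1) k with h | h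
  · exact bcmp_ne (h1 j h)
  · exact bcmp_ne (h2 j (by omega))

lemma GoodSeq.inj {α : Type*} [Preorder α] {N : ℕ} {a : ℕ → α} (h : GoodSeq N a) {j k : ℕ}
    (hj : j < N) (hk : k < N) (e : a j = a k) : j = k := by
  rcases lt_trichotomy j k with h' | h' | h'
  · exact absurd e (h.ne h' hk)
  · exact h'
  · exact absurd e.symm (h.ne h' hj)

lemma GoodSeq.congr {α β : Type*} [LT α] [LT β] {N : ℕ} {a : ℕ → α} {c : ℕ → β}
    (h : GoodSeq N a) (hc : ∀ i < N, ∀ j < N, (a i < a j ↔ c i < c j)) : GoodSeq N c := by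
  intro k hk
  obtain ⟨b, h1, h2⟩ := h k hk
  refine ⟨b, fun j hj => ?_, fun j hj => ?_⟩
  · exact (bcmp_iff (hc _ (by omega) _ (by omega)) (hc _ (by omega) _ (by omega)) _).1 (h1 j hj)
  · exact (bcmp_iff (hc _ (by omega) _ (by omega)) (hc _ (by omega) _ (by omega)) _).1 (h2 j hj)

lemma GoodSeq.reindex {α : Type*} [LT α] {M N : ℕ} {a : ℕ → α} (h : GoodSeq M a) (e : ℕ → ℕ)
    (he : ∀ i < N, e i < M) (hm : ∀ i j, i < j → j < N → e i < e j) :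
    GoodSeq N (fun k => a (e k)) := by
  intro k hk
  obtain ⟨b, h1, h2⟩ := h (e k) (he k hk)
  refine ⟨(b.1, if e (k - 1) + 1 = e k then b.2 else b.1), fun j hj => ?_, fun j hj => ?_⟩
  · have := hm j (j + 1) (by omega) (by omega)
    have := hm (j + 1) k (by omega) (by omega)
    exact h1 _ (by omega)
  · subst hj
    have := hm j (j + 1) (by omega) (by omega)
    simp only [Nat.add_sub_cancel]
    split_ifs with hh
    · exact h2 _ hh
    · exact h1 _ (by omega)

/-- same codes imply same comparisons -/
lemma code_det {α β : Type*} [Preorder α] [Preorder β] {N : ℕ} {a : ℕ → α} {c : ℕ → β}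
    {b : ℕ → Bool × Bool}
    (ha : ∀ k < N, GoodAt a k (b k)) (hc : ∀ k < N, GoodAt c k (b k)) :
    ∀ i < N, ∀ j < N, (a i < a j ↔ c i < c j) := by
  have key : ∀ i j, i < j → j < N → ((a i < a j ↔ c i < c j) ∧ (a j < a i ↔ c j < c i)) := by
    intro i j hij hj
    obtain ⟨a1, a2⟩ := ha j hj
    obtain ⟨c1, c2⟩ := hc j hj
    have : ∃ d, bcmp d (a i) (a j) ∧ bcmp d (c i) (c j) := by
      rcases Nat.lt_or_ge (i + 1) j with h | h
      · exact ⟨_, a1 i h, c1 i h⟩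
      · exact ⟨_, a2 i (by omega), c2 i (by omega)⟩
    obtain ⟨d, h1, h2⟩ := this
    cases d <;> simp only [bcmp] at h1 h2 <;> simp at h1 h2 <;>
      simp [h1, h2, h1.not_gt, h2.not_gt]
  intro i hi j hj
  rcases lt_trichotomy i j with h | h | h
  · exact (key i j h hj).1
  · subst h; simp
  · exact (key j i h hi).2

lemma GoodSeq.box {N M : ℕ} {a b c : ℕ → ℕ} (hN : 0 < N) (ha : GoodSeq N a)
    (haN : ∀ j < N, a j < N) (hb : GoodSeq M b)
    (h1 : ∀ k < N, c k = a k + b 0)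
    (h2 : ∀ k, N ≤ k → k + 1 < N + M → c k = CPerm.sh (b 0) N (b (k - N + 1))) :
    ∀ K, K + 1 ≤ N + M → GoodSeq K c := by
  intro K hK k hk
  have out : ∀ (d : Bool) j m, j < N → bcmp d (b 0) (b m) →
      bcmp d (a j + b 0) (CPerm.sh (b 0) N (b m)) := by
    intro d j m hj hd
    have := haN j hj
    cases d <;> simp [bcmp, CPerm.sh] at hd ⊢ <;> split_ifs <;> omega
  have inn : ∀ (d : Bool) l m, bcmp d (b l) (b m) →
      bcmp d (CPerm.sh (b 0) N (b l)) (CPerm.sh (b 0) N (b m)) := by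
    intro d l m hd
    cases d <;> simp [bcmp, CPerm.sh] at hd ⊢ <;> split_ifs <;> omega
  by_cases hkN : k < N
  · obtain ⟨d, e1, e2⟩ := ha k hkN
    refine ⟨d, fun j hj => ?_, fun j hj => ?_⟩
    · have := e1 j hj
      rw [h1 j (by omega), h1 k hkN]
      exact (bcmp_iff (by omega) (by omega) _).1 this
    · have := e2 j hj
      rw [h1 j (by omega), h1 k hkN]
      exact (bcmp_iff (by omega) (by omega) _).1 this
  · obtain ⟨d, e1, e2⟩ := hb (k - N + 1) (by omega)
    rcases Nat.lt_or_ge N k with hk' | hk'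
    · refine ⟨d, fun j hj => ?_, fun j hj => ?_⟩
      · rw [h2 k (by omega) (by omega)]
        by_cases hjN : j < N
        · rw [h1 j hjN]
          exact out _ _ _ hjN (e1 0 (by omega))
        · rw [h2 j (by omega) (by omega)]
          exact inn _ _ _ (e1 _ (by omega))
      · rw [h2 k (by omega) (by omega), h2 j (by omega) (by omega)]
        exact inn _ _ _ (e2 _ (by omega))
    · refine ⟨(d.2, d.2), fun j hj => ?_, fun j hj => ?_⟩
      · rw [h2 k (by omega) (by omega), h1 j (by omega)]
        exact out _ _ _ (by omega) (e2 0 (by omega))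
      · rw [h2 k (by omega) (by omega), h1 j (by omega)]
        exact out _ _ _ (by omega) (e2 0 (by omega))

namespace CPerm

/-- `p` can be drawn point by point (normalised form). -/
def DrawnN (p : CPerm) : Prop :=
  0 < p.vals.length ∧ (∀ i < p.vals.length, p.valAt i < p.vals.length) ∧
  ∃ σ : ℕ → ℕ, (∀ k < p.vals.length, σ k < p.vals.length) ∧ σ 0 = p.origin ∧
    GoodSeq p.vals.length σ ∧ GoodSeq p.vals.length (fun k => p.valAt (σ k))

def Drawn (p : CPerm) : Prop :=
  ∃ (M : ℕ) (x y : ℕ → ℚ) (t : ℕ → ℕ), GoodSeq M x ∧ GoodSeq M y ∧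
    (∀ i < p.vals.length, t i < M) ∧ t p.origin = 0 ∧
    (∀ i < p.vals.length, ∀ j < p.vals.length, (i < j ↔ x (t i) < x (t j))) ∧
    (∀ i < p.vals.length, ∀ j < p.vals.length, (p.valAt i < p.valAt j ↔ y (t i) < y (t j)))

lemma Drawn.normal {p : CPerm} (h : p.Drawn) (ho : p.origin < p.vals.length)
    (hv : ∀ i < p.vals.length, p.valAt i < p.vals.length) : p.DrawnN := by
  obtain ⟨M, x, y, t, hx, hy, ht, h0, h1, h2⟩ := h
  refine ⟨by omega, hv, ?_⟩
  set N := p.vals.length with hN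
  have tinj : ∀ i < N, ∀ j < N, t i = t j → i = j := by
    intro i hi j hj e
    have a1 := h1 i hi j hj
    have a2 := h1 j hj i hi
    rw [e] at a1 a2
    simp at a1 a2
    omega
  let s : Equiv.Perm (Fin N) := Tuple.sort (fun i : Fin N => t i)
  have hs : Monotone (fun i => t (s i)) := Tuple.monotone_sort (fun i : Fin N => t i)
  let σ : ℕ → ℕ := fun k => if h : k < N then s ⟨k, h⟩ else 0
  have σlt : ∀ k < N, σ k < N := by
    intro k hk; simp only [σ, dif_pos hk]; exact (s _).2
  have mono : ∀ i j, i < j → j < N → t (σ i) < t (σ j) := by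
    intro i j hij hj
    have hi : i < N := by omega
    have l1 : t (σ i) ≤ t (σ j) := by
      simp only [σ, dif_pos hi, dif_pos hj]
      exact hs (show (⟨i, hi⟩ : Fin N) ≤ ⟨j, hj⟩ from by simp; omega)
    refine lt_of_le_of_ne l1 fun e => ?_
    have := tinj _ (σlt i hi) _ (σlt j hj) e
    simp only [σ, dif_pos hi, dif_pos hj] at this
    have := s.injective (Fin.ext this)
    simp at this
    omega
  refine ⟨σ, σlt, ?_, ?_, ?_⟩
  · have : σ (s.symm ⟨p.origin, ho⟩) = p.origin := by simp [σ]
    rcases Nat.eq_zero_or_pos (s.symm ⟨p.origin, ho⟩ : ℕ) with h | h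
    · rw [← this, h]
    · have := mono _ _ h (s.symm ⟨p.origin, ho⟩).2
      rw [‹σ (s.symm ⟨p.origin, ho⟩) = p.origin›, h0] at this
      omega
  · refine (hx.reindex (fun k => t (σ k)) (fun i hi => ht _ (σlt i hi)) mono).congr ?_
    intro i hi j hj
    exact (h1 _ (σlt i hi) _ (σlt j hj)).symm
  · refine (hy.reindex (fun k => t (σ k)) (fun i hi => ht _ (σlt i hi)) mono).congr ?_
    intro i hi j hj
    exact (h2 _ (σlt i hi) _ (σlt j hj)).symm

lemma DrawnN.pattern {p q : CPerm} (hq : q.DrawnN) (hp : p.IsValid) (h : PatternLE p q) :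
    p.DrawnN := by
  obtain ⟨hq0, -, σ, σlt, σ0, g1, g2⟩ := hq
  obtain ⟨f, f1, f2, f3, f4⟩ := h
  refine Drawn.normal ?_ hp.2.1 (fun i hi => valid_lt hp hi)
  have surj : ∀ i < q.vals.length, ∃ k < q.vals.length, σ k = i := by
    intro i hi
    have hb : Function.Injective (fun k : Fin q.vals.length =>
        (⟨σ k, σlt k k.2⟩ : Fin q.vals.length)) := by
      intro a b e
      simp only [Fin.mk.injEq] at e
      exact Fin.ext (g1.inj a.2 b.2 e)
    obtain ⟨k, hk⟩ := (Finite.injective_iff_surjective.1 hb) ⟨i, hi⟩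
    exact ⟨k, k.2, by simpa using hk⟩
  have : ∀ i, ∃ k, i < q.vals.length → k < q.vals.length ∧ σ k = i := by
    intro i
    by_cases hi : i < q.vals.length
    · obtain ⟨k, hk⟩ := surj i hi; exact ⟨k, fun _ => hk⟩
    · exact ⟨0, fun h => absurd h hi⟩
  choose τ hτ using this
  refine ⟨q.vals.length, fun k => (σ k : ℚ), fun k => (q.valAt (σ k) : ℚ), fun i => τ (f i),
    g1.congr (by simp), g2.congr (by simp), fun i hi => (hτ _ (f2 i hi)).1, ?_, ?_, ?_⟩
  · have h := hτ _ (f2 _ hp.2.1)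
    exact g1.inj h.1 hq0 (by rw [h.2, f3, σ0])
  · intro i hi j hj
    beta_reduce
    rw [(hτ _ (f2 i hi)).2, (hτ _ (f2 j hj)).2, Nat.cast_lt]
    refine ⟨f1 i j hi hj, fun h => ?_⟩
    rcases lt_trichotomy i j with h' | h' | h'
    · exact h'
    · subst h'; omega
    · have := f1 j i hj hi h'; omega
  · intro i hi j hj
    beta_reduce
    rw [(hτ _ (f2 i hi)).2, (hτ _ (f2 j hj)).2, Nat.cast_lt]
    exact f4 i j hi hj

lemma drawnN_trivial : trivial.DrawnN := by
  refine ⟨by simp [trivial], by simp [trivial, valAt], fun k => k, by simp [trivial],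
    by simp [trivial], ?_, ?_⟩ <;>
  · intro k hk
    simp [trivial] at hk
    subst hk
    exact ⟨(true, true), by intro j hj; omega, by intro j hj; omega⟩

lemma sh_lt {o N M u : ℕ} (h : u < M) (hN : 0 < N) : sh o N u + 1 < N + M := by
  unfold sh; split_ifs <;> omega

lemma DrawnN.origin_lt {q : CPerm} (hq : q.DrawnN) : q.origin < q.vals.length := by
  obtain ⟨hq0, qv, τ, τlt, τ0, k1, k2⟩ := hq
  rw [← τ0]; exact τlt 0 hq0

lemma DrawnN.box {p q : CPerm} (hp : p.DrawnN) (hq : q.DrawnN) : (boxSum p q).DrawnN := by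
  have hqo := hq.origin_lt
  obtain ⟨hp0, pv, σ, σlt, σ0, g1, g2⟩ := hp
  obtain ⟨hq0, qv, τ, τlt, τ0, k1, k2⟩ := hq
  have hlen := boxSum_length (p := p) hqo
  let ρ : ℕ → ℕ := fun k => if k < p.vals.length then σ k + q.origin
    else sh q.origin p.vals.length (τ (k - p.vals.length + 1))
  have ρ1 : ∀ k < p.vals.length, ρ k = σ k + q.origin := fun k hk => by simp [ρ, hk]
  have ρ2 : ∀ k, p.vals.length ≤ k → ρ k = sh q.origin p.vals.length (τ (k - p.vals.length + 1)) :=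
    fun k hk => by simp [ρ, Nat.not_lt.2 hk]
  refine ⟨by omega, ?_, ρ, ?_, ?_, ?_, ?_⟩
  · intro i hi
    by_cases h1 : i < q.origin
    · have := boxSum_valAt_out hp0 (show i < q.vals.length by omega) hqo (by omega)
      have e : sh q.origin p.vals.length i = i := by simp [sh, h1]
      rw [e] at this
      rw [this]
      have := sh_lt (o := q.originVal) (qv i (by omega)) hp0
      omega
    · by_cases h2 : i < q.origin + p.vals.length
      · obtain ⟨j, rfl⟩ := Nat.exists_eq_add_of_le (Nat.not_lt.1 h1)
        rw [boxSum_valAt_block hqo (by omega)]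
        have := pv j (by omega)
        have := qv _ hqo
        have e : q.originVal = q.valAt q.origin := rfl
        omega
      · have := boxSum_valAt_out hp0 (i := i - (p.vals.length - 1)) (by omega) hqo (by omega)
        have e : sh q.origin p.vals.length (i - (p.vals.length - 1)) = i := by
          unfold sh; split_ifs <;> omega
        rw [e] at this
        rw [this]
        have := sh_lt (o := q.originVal) (qv (i - (p.vals.length - 1)) (by omega)) hp0
        omega
  · intro k hk
    by_cases h : k < p.vals.length
    · rw [ρ1 k h]; have := σlt k h; omega
    · rw [ρ2 k (by omega)]
      have := sh_lt (o := q.origin) (τlt (k - p.vals.length + 1) (by omega)) hp0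
      omega
  · rw [ρ1 0 hp0, σ0, boxSum_origin]; omega
  · refine GoodSeq.box hp0 g1 σlt k1 ?_ ?_ _ (by omega)
    · intro k hk; rw [ρ1 k hk, τ0]
    · intro k hk _; rw [ρ2 k hk, τ0]
  · refine GoodSeq.box hp0 g2 (fun j hj => pv _ (σlt j hj)) k2 ?_ ?_ _ (by omega)
    · intro k hk
      rw [ρ1 k hk, τ0, add_comm, boxSum_valAt_block hqo (σlt k hk)]; rfl
    · intro k hk hk'
      rw [ρ2 k hk, τ0, boxSum_valAt_out hp0 (τlt _ (by omega)) hqo]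
      · rfl
      · rw [← τ0]
        exact (k1.ne (by omega) (by omega)).symm

end CPerm

/-- list form of the drawing condition, newest entry first -/
def StepL (x : ℚ) (L : List ℚ) : Prop :=
  (∃ b, ∀ z ∈ L, bcmp b z x) ∨ ∃ y R, L = y :: R ∧ ∃ b, bcmp (!b) y x ∧ ∀ z ∈ R, bcmp b z x

def GoodL : List ℚ → Prop
  | [] => True
  | x :: L => StepL x L ∧ GoodL L

lemma GoodL.seq {L : List ℚ} (h : GoodL L) : GoodSeq L.length (fun k => L.reverse.getD k 0) := by
  induction L with
  | nil => intro k hk; simp at hk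
  | cons x L ih =>
    obtain ⟨hs, hL⟩ := h
    have e1 : ∀ k < L.length, (x :: L).reverse.getD k 0 = L.reverse.getD k 0 := by
      intro k hk
      rw [List.reverse_cons, List.getD_append _ _ _ _ (by simpa using hk)]
    have e2 : (x :: L).reverse.getD L.length 0 = x := by
      rw [List.reverse_cons, List.getD_append_right _ _ _ _ (by simp)]
      simp
    have mem : ∀ (R : List ℚ) j, j < R.length → R.reverse.getD j 0 ∈ R := by
      intro R j hj
      rw [List.getD_eq_getElem _ _ (by simpa using hj)]
      exact List.mem_reverse.1 (List.getElem_mem _)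
    intro k hk
    rcases Nat.lt_succ_iff_lt_or_eq.1 hk with hk' | hk'
    · obtain ⟨b, h1, h2⟩ := ih hL k hk'
      refine ⟨b, fun j hj => ?_, fun j hj => ?_⟩
      · beta_reduce; rw [e1 j (by omega), e1 k hk']; exact h1 j hj
      · beta_reduce; rw [e1 j (by omega), e1 k hk']; exact h2 j hj
    · subst hk'
      rcases hs with ⟨b, hb⟩ | ⟨y, R, rfl, b, hb1, hb2⟩
      · refine ⟨(b, b), fun j hj => ?_, fun j hj => ?_⟩
        · beta_reduce; rw [e1 j (by omega), e2]; exact hb _ (mem _ _ (by omega))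
        · beta_reduce; rw [e1 j (by omega), e2]; exact hb _ (mem _ _ (by omega))
      · refine ⟨(b, !b), fun j hj => ?_, fun j hj => ?_⟩
        · beta_reduce; rw [e1 j (by omega), e2]
          simp only [List.length_cons] at hj
          rw [List.reverse_cons, List.getD_append _ _ _ _ (by simp; omega)]
          exact hb2 _ (mem _ _ (by omega))
        · beta_reduce; rw [e1 j (by omega), e2]
          simp only [List.length_cons] at hj
          have : j = R.length := by omega
          subst this
          rw [List.reverse_cons, List.getD_append_right _ _ _ _ (by simp)]
          simpa using hb1

lemma le_maxOf {l : List ℚ} : (0 ≤ maxOf l) ∧ ∀ z ∈ l, z ≤ maxOf l := by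
  induction l with
  | nil => simp [maxOf]
  | cons a l ih =>
    have e : maxOf (a :: l) = max a (maxOf l) := rfl
    rw [e]
    refine ⟨le_max_of_le_right ih.1, ?_⟩
    intro z hz
    rcases List.mem_cons.1 hz with rfl | hz
    · exact le_max_left _ _
    · exact le_max_of_le_right (ih.2 z hz)

lemma minOf_le {l : List ℚ} : (minOf l ≤ 0) ∧ ∀ z ∈ l, minOf l ≤ z := by
  induction l with
  | nil => simp [minOf]
  | cons a l ih =>
    have e : minOf (a :: l) = min a (minOf l) := rfl
    rw [e]
    refine ⟨min_le_of_right_le ih.1, ?_⟩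
    intro z hz
    rcases List.mem_cons.1 hz with rfl | hz
    · exact min_le_left _ _
    · exact min_le_of_right_le (ih.2 z hz)

lemma maxOf_lt {l : List ℚ} {a : ℚ} (h0 : 0 < a) (h : ∀ z ∈ l, z < a) : maxOf l < a := by
  induction l with
  | nil => simpa [maxOf]
  | cons b l ih =>
    exact max_lt (h b (by simp)) (ih fun z hz => h z (by simp [hz]))

lemma lt_minOf {l : List ℚ} {a : ℚ} (h0 : a < 0) (h : ∀ z ∈ l, a < z) : a < minOf l := by
  induction l with
  | nil => simpa [minOf]
  | cons b l ih =>
    exact lt_min (h b (by simp)) (ih fun z hz => h z (by simp [hz]))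

/-- the newest entry is extremal -/
def ExtL : List ℚ → Prop
  | [] => True
  | x :: L => ∃ b, ∀ z ∈ L, bcmp b z x

lemma btw_step {y : ℚ} {R : List ℚ} (h0 : (0 : ℚ) ∈ R) (h : ExtL (y :: R)) :
    StepL (if maxOf R < y then (y + maxOf R) / 2 else (y + minOf R) / 2) (y :: R) := by
  obtain ⟨b, hb⟩ := h
  right
  refine ⟨y, R, rfl, b, ?_⟩
  cases b
  · simp only [bcmp] at hb ⊢
    simp at hb ⊢
    have h1 := lt_minOf (hb 0 h0) hb
    have h2 := hb 0 h0
    have h3 := (le_maxOf (l := R)).1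
    rw [if_neg (by linarith)]
    refine ⟨by linarith, fun z hz => ?_⟩
    have := (minOf_le (l := R)).2 z hz
    linarith
  · simp only [bcmp] at hb ⊢
    simp at hb ⊢
    have h1 := maxOf_lt (hb 0 h0) hb
    rw [if_pos h1]
    refine ⟨by linarith, fun z hz => ?_⟩
    have := (le_maxOf (l := R)).2 z hz
    linarith

lemma max_ext (L : List ℚ) : ExtL ((maxOf L + 1) :: L) := by
  refine ⟨true, fun z hz => ?_⟩
  simp only [bcmp]
  have := (le_maxOf (l := L)).2 z hz
  simp; linarith

lemma min_ext (L : List ℚ) : ExtL ((minOf L - 1) :: L) := by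
  refine ⟨false, fun z hz => ?_⟩
  simp only [bcmp]
  have := (minOf_le (l := L)).2 z hz
  simp; linarith

lemma ExtL.step {x : ℚ} {L : List ℚ} (h : ExtL (x :: L)) : StepL x L := Or.inl h

lemma pin_foldl (ls : List PinLetter) : ∀ (p : ℚ × ℚ) (R : List (ℚ × ℚ)), PinAlt ls →
    ((0 : ℚ), (0 : ℚ)) ∈ R → GoodL ((p :: R).map Prod.fst) → GoodL ((p :: R).map Prod.snd) →
    (∀ a ∈ ls.head?, if a.isVert then ExtL ((p :: R).map Prod.fst)
      else ExtL ((p :: R).map Prod.snd)) →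
    ∃ Q, ls.foldl pinStep (p :: R) = Q ++ (p :: R) ∧
    GoodL ((Q ++ (p :: R)).map Prod.fst) ∧ GoodL ((Q ++ (p :: R)).map Prod.snd) := by
  induction ls with
  | nil => intro p R _ _ h1 h2 _; exact ⟨[], rfl, h1, h2⟩
  | cons a ls ih =>
    intro p R halt h0 h1 h2 h3
    have h3 := h3 a (by simp)
    have halt' : PinAlt ls := (List.isChain_cons.1 halt).2
    have hhead : ∀ c ∈ ls.head?, a.isVert ≠ c.isVert := (List.isChain_cons.1 halt).1
    have h0x : (0 : ℚ) ∈ R.map Prod.fst := List.mem_map.2 ⟨_, h0, rfl⟩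
    have h0y : (0 : ℚ) ∈ R.map Prod.snd := List.mem_map.2 ⟨_, h0, rfl⟩
    have main : ∃ n : ℚ × ℚ, pinStep (p :: R) a = n :: p :: R ∧
        StepL n.1 ((p :: R).map Prod.fst) ∧ StepL n.2 ((p :: R).map Prod.snd) ∧
        if a.isVert then ExtL ((n :: p :: R).map Prod.snd)
        else ExtL ((n :: p :: R).map Prod.fst) := by
      cases a
      · exact ⟨_, rfl, btw_step h0x h3, (max_ext _).step, max_ext _⟩
      · exact ⟨_, rfl, btw_step h0x h3, (min_ext _).step, min_ext _⟩
      · exact ⟨_, rfl, (min_ext _).step, btw_step h0y h3, min_ext _⟩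
      · exact ⟨_, rfl, (max_ext _).step, btw_step h0y h3, max_ext _⟩
    obtain ⟨n, e, s1, s2, s3⟩ := main
    obtain ⟨Q, e', g1, g2⟩ := ih n (p :: R) halt' (by simp [h0]) ⟨s1, h1⟩ ⟨s2, h2⟩ (by
      intro c hc
      have := hhead c hc
      cases ha : a.isVert <;> cases hc' : c.isVert <;> simp_all)
    refine ⟨Q ++ [n], ?_, ?_, ?_⟩
    · rw [List.foldl_cons, e, e']; simp
    · simpa using g1
    · simpa using g2

lemma pinPts_good {q : ℕ} {ls : List PinLetter} (h : IsPinWord q ls) :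
    ∃ Q, pinPts q ls = Q ++ [(0, 0)] ∧ GoodL ((pinPts q ls).map Prod.fst) ∧
      GoodL ((pinPts q ls).map Prod.snd) := by
  obtain ⟨h1, h2, halt⟩ := h
  have e1 : ExtL ([firstPt q, (0, 0)].map Prod.fst) := by
    interval_cases q <;> simp [firstPt, ExtL, bcmp]
  have e2 : ExtL ([firstPt q, (0, 0)].map Prod.snd) := by
    interval_cases q <;> simp [firstPt, ExtL, bcmp]
  have g0 : GoodL [0] := ⟨Or.inl ⟨true, by simp⟩, True.intro⟩
  obtain ⟨Q, e, a, b⟩ := pin_foldl ls (firstPt q) [(0, 0)] halt (by simp)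
    ⟨e1.step, g0⟩ ⟨e2.step, g0⟩ (by intro a _; split_ifs; exacts [e1, e2])
  refine ⟨Q ++ [firstPt q], ?_, ?_, ?_⟩
  · rw [pinPts, e]; simp
  · rw [pinPts, e]; exact a
  · rw [pinPts, e]; exact b

lemma filter_rank {L : List (ℚ × ℚ)} {y z : ℚ} (hy : y ∈ L.map Prod.snd) :
    y < z ↔ ((L.map Prod.snd).filter (fun w => decide (w < y))).length
      < ((L.map Prod.snd).filter (fun w => decide (w < z))).length := by
  simp only [← List.countP_eq_length_filter]
  have mono : ∀ (l : List ℚ) {u v : ℚ}, u ≤ v →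
      l.countP (fun w => decide (w < u)) ≤ l.countP (fun w => decide (w < v)) := by
    intro l u v huv
    apply List.countP_mono_left
    intro w _ hw
    simp at hw ⊢; linarith
  constructor
  · intro h
    obtain ⟨A, B, e⟩ := List.append_of_mem hy
    rw [e]
    simp only [List.countP_append, List.countP_cons]
    have := mono A h.le
    have := mono B h.le
    simp [h]
    omega
  · intro h
    by_contra hc
    have := mono (L.map Prod.snd) (not_lt.1 hc)
    omega

lemma rank_lt {L : List (ℚ × ℚ)} {y : ℚ} (hy : y ∈ L.map Prod.snd) :
    ((L.map Prod.snd).filter (fun w => decide (w < y))).length < L.length := by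
  have := List.length_filter_lt_length_iff_exists (l := L.map Prod.snd)
    (p := fun w => decide (w < y))
  rw [List.length_map] at this
  exact this.2 ⟨y, hy, by simp⟩

lemma toCPerm_drawn {pts : List (ℚ × ℚ)} {Q : List (ℚ × ℚ)} (hQ : pts = Q ++ [(0, 0)])
    (g1 : GoodL (pts.map Prod.fst)) (g2 : GoodL (pts.map Prod.snd)) : (toCPerm pts).DrawnN := by
  set L := pts.mergeSort (fun a b => decide (a.1 ≤ b.1)) with hL
  have perm : L.Perm pts := List.mergeSort_perm _ _
  have hlen : L.length = pts.length := perm.length_eq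
  have hvl : (toCPerm pts).vals.length = L.length := by simp [toCPerm, ← hL]
  have hsort : L.Pairwise (fun a b => a.1 ≤ b.1) := by
    have := List.pairwise_mergeSort (le := fun a b : ℚ × ℚ => decide (a.1 ≤ b.1))
      (by intro a b c; simp; exact le_trans) (by intro a b; simp; exact le_total _ _) pts
    simpa using this
  have G1 := g1.seq
  have G2 := g2.seq
  rw [List.length_map] at G1 G2
  have ex : ∀ k < pts.length, (pts.map Prod.fst).reverse.getD k 0 = (pts.reverse.getD k (0,0)).1 := by
    intro k hk
    rw [List.getD_eq_getElem _ _ (by simpa using hk), List.getD_eq_getElem _ _ (by simpa using hk)]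
    simp
  have ey : ∀ k < pts.length, (pts.map Prod.snd).reverse.getD k 0 = (pts.reverse.getD k (0,0)).2 := by
    intro k hk
    rw [List.getD_eq_getElem _ _ (by simpa using hk), List.getD_eq_getElem _ _ (by simpa using hk)]
    simp
  have nd : (pts.map Prod.fst).Nodup := by
    rw [← List.nodup_reverse, List.nodup_iff_injective_get]
    intro a b e
    have ha : (a : ℕ) < pts.length := by simpa using a.2
    have hb : (b : ℕ) < pts.length := by simpa using b.2
    refine Fin.ext (G1.inj ha hb ?_)
    beta_reduce
    rw [List.getD_eq_getElem _ _ a.2, List.getD_eq_getElem _ _ b.2]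
    exact e
  have ndL : (L.map Prod.fst).Nodup := (perm.map Prod.fst).nodup_iff.2 nd
  have hlt : L.Pairwise (fun a b => a.1 < b.1) := by
    have h1 : L.Pairwise (fun a b => a.1 ≠ b.1) := List.pairwise_map.1 ndL
    exact (hsort.and h1).imp fun h => lt_of_le_of_ne h.1 h.2
  have hor : ∃ h : (toCPerm pts).origin < L.length, L[(toCPerm pts).origin] = (0, 0) := by
    have h0 : ((0 : ℚ), (0 : ℚ)) ∈ L := perm.mem_iff.2 (by rw [hQ]; simp)
    obtain ⟨A, B, e⟩ := List.append_of_mem h0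
    have : (toCPerm pts).origin = A.length := by
      have e1 : (toCPerm pts).origin
          = ((pts.map Prod.fst).filter (fun x => decide (x < 0))).length := rfl
      rw [e1, ← ((perm.map Prod.fst).filter _).length_eq, e]
      rw [e, List.pairwise_append, List.pairwise_cons] at hlt
      obtain ⟨-, ⟨hB, -⟩, hA⟩ := hlt
      have f1 : (A.map Prod.fst).filter (fun x => decide (x < 0)) = A.map Prod.fst := by
        rw [List.filter_eq_self]
        intro a ha
        obtain ⟨z, hz, rfl⟩ := List.mem_map.1 ha
        simpa using hA z hz (0, 0) (by simp)
      have f2 : (B.map Prod.fst).filter (fun x => decide (x < 0)) = [] := by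
        rw [List.filter_eq_nil_iff]
        intro a ha
        obtain ⟨z, hz, rfl⟩ := List.mem_map.1 ha
        simpa using (hB z hz).le
      rw [List.map_append, List.map_cons, List.filter_append, List.filter_cons, f1, f2]
      simp
    rw [this]
    refine ⟨by rw [e]; simp, ?_⟩
    simp [e]
  obtain ⟨ho, ho'⟩ := hor
  have hval : ∀ i (hi : i < L.length), (toCPerm pts).valAt i
      = ((pts.map Prod.snd).filter (fun y => decide (y < L[i].2))).length := by
    intro i hi
    rw [CPerm.valAt_eq (by omega)]
    simp [toCPerm, ← hL]
  have memy : ∀ i (hi : i < L.length), L[i].2 ∈ pts.map Prod.snd := fun i hi =>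
    List.mem_map.2 ⟨L[i], perm.mem_iff.1 (List.getElem_mem hi), rfl⟩
  have ht : ∀ i, ∃ k, ∀ h : i < L.length, k < pts.length ∧ pts.reverse.getD k (0,0) = L[i] := by
    intro i
    by_cases hi : i < L.length
    · have : L[i] ∈ pts.reverse := List.mem_reverse.2 (perm.mem_iff.1 (List.getElem_mem hi))
      obtain ⟨k, hk, e⟩ := List.getElem_of_mem this
      exact ⟨k, fun _ => ⟨by simpa using hk, by rw [List.getD_eq_getElem _ _ hk, e]⟩⟩
    · exact ⟨0, fun h => absurd h hi⟩
  choose t ht using ht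
  refine CPerm.Drawn.normal ?_ (by omega) ?_
  · refine ⟨pts.length, _, _, t, G1, G2, fun i hi => (ht i (by omega)).1, ?_, ?_, ?_⟩
    · obtain ⟨a1, a2⟩ := ht _ ho
      refine G1.inj a1 (by omega) ?_
      beta_reduce
      rw [ex _ a1, ex _ (by omega), a2, ho', hQ]
      simp
    · intro i hi j hj
      rw [hvl] at hi hj
      beta_reduce
      rw [ex _ (ht i hi).1, ex _ (ht j hj).1, (ht i hi).2, (ht j hj).2]
      have key : ∀ i j (hi : i < L.length) (hj : j < L.length), i < j → L[i].1 < L[j].1 :=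
        fun i j hi hj h => List.pairwise_iff_getElem.1 hlt i j hi hj h
      refine ⟨key i j hi hj, fun h => ?_⟩
      rcases lt_trichotomy i j with h' | h' | h'
      · exact h'
      · subst h'; exact absurd h (lt_irrefl _)
      · exact absurd (key j i hj hi h') h.not_gt
    · intro i hi j hj
      rw [hvl] at hi hj
      beta_reduce
      rw [ey _ (ht i hi).1, ey _ (ht j hj).1, (ht i hi).2, (ht j hj).2, hval i hi, hval j hj]
      exact (filter_rank (memy i hi)).symm
  · intro i hi
    rw [hvl] at hi ⊢
    rw [hval i hi, hlen]
    exact rank_lt (memy i hi)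

lemma pinPerm_drawn {q : ℕ} {ls : List PinLetter} (h : IsPinWord q ls) :
    (pinPerm q ls).DrawnN := by
  obtain ⟨Q, e, h1, h2⟩ := pinPts_good h
  exact toCPerm_drawn e h1 h2

lemma complete_drawn {p : CPerm} (h : p ∈ CompletePinClass) : p.DrawnN := by
  obtain ⟨hv, ws, hws, hle⟩ := h
  refine CPerm.DrawnN.pattern ?_ hv hle
  clear hle
  induction ws with
  | nil => exact CPerm.drawnN_trivial
  | cons w ws ih =>
    exact (pinPerm_drawn (hws w (by simp))).box (ih fun w hw => hws w (by simp [hw]))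

namespace CPerm

/-- codes determine the permutation -/
lemma drawn_ext {p p' : CPerm} {N : ℕ} (hN : p.vals.length = N) (hN' : p'.vals.length = N)
    (hN0 : 0 < N) (pv : ∀ i < N, p.valAt i < N) (pv' : ∀ i < N, p'.valAt i < N)
    {σ σ' : ℕ → ℕ} (s : ∀ k < N, σ k < N) (s' : ∀ k < N, σ' k < N)
    (s0 : σ 0 = p.origin) (s0' : σ' 0 = p'.origin)
    {b c : ℕ → Bool × Bool}
    (h1 : ∀ k < N, GoodAt σ k (b k)) (h1' : ∀ k < N, GoodAt σ' k (b k))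
    (h2 : ∀ k < N, GoodAt (fun k => p.valAt (σ k)) k (c k))
    (h2' : ∀ k < N, GoodAt (fun k => p'.valAt (σ' k)) k (c k)) : p = p' := by
  have rank : ∀ (f g : ℕ → ℕ), (∀ k < N, f k < N) → (∀ k < N, g k < N) →
      (∀ i < N, ∀ j < N, f i = f j → i = j) → (∀ i < N, ∀ j < N, g i = g j → i = j) →
      (∀ i < N, ∀ j < N, (f i < f j ↔ g i < g j)) → ∀ k < N, f k = g k := by
    have cnt : ∀ (f : ℕ → ℕ), (∀ k < N, f k < N) → (∀ i < N, ∀ j < N, f i = f j → i = j) →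
        ∀ k < N, f k = ((Finset.range N).filter (fun i => f i < f k)).card := by
      intro f hf hi k hk
      have himg : (Finset.range N).image f = Finset.range N := by
        apply Finset.eq_of_subset_of_card_le
        · intro x hx
          obtain ⟨i, hi', rfl⟩ := Finset.mem_image.1 hx
          simpa using hf i (by simpa using hi')
        · rw [Finset.card_image_of_injOn]
          intro x hx y hy e
          exact hi x (by simpa using hx) y (by simpa using hy) e
      have : ((Finset.range N).filter (fun i => f i < f k)).image f = Finset.range (f k) := by
        ext x
        simp only [Finset.mem_image, Finset.mem_filter, Finset.mem_range]
        constructor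
        · rintro ⟨i, ⟨_, h⟩, rfl⟩; exact h
        · intro hx
          have : x ∈ (Finset.range N).image f := by
            rw [himg]; have := hf k hk; simp; omega
          obtain ⟨i, hi', rfl⟩ := Finset.mem_image.1 this
          exact ⟨i, ⟨by simpa using hi', hx⟩, rfl⟩
      conv_lhs => rw [← Finset.card_range (f k), ← this]
      rw [Finset.card_image_of_injOn]
      intro x hx y hy e
      simp at hx hy
      exact hi x hx.1 y hy.1 e
    intro f g hf hg fi gi h k hk
    rw [cnt f hf fi k hk, cnt g hg gi k hk]
    congr 1
    apply Finset.filter_congr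
    intro i hi
    exact h i (by simpa using hi) k hk
  have G1 : GoodSeq N σ := fun k hk => ⟨_, h1 k hk⟩
  have G1' : GoodSeq N σ' := fun k hk => ⟨_, h1' k hk⟩
  have G2 : GoodSeq N (fun k => p.valAt (σ k)) := fun k hk => ⟨_, h2 k hk⟩
  have G2' : GoodSeq N (fun k => p'.valAt (σ' k)) := fun k hk => ⟨_, h2' k hk⟩
  have e1 : ∀ k < N, σ k = σ' k := rank σ σ' s s' (fun i hi j hj => G1.inj hi hj)
    (fun i hi j hj => G1'.inj hi hj) (code_det h1 h1')
  have e2 : ∀ k < N, p.valAt (σ k) = p'.valAt (σ' k) :=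
    rank (fun k => p.valAt (σ k)) (fun k => p'.valAt (σ' k)) (fun k hk => pv _ (s k hk))
      (fun k hk => pv' _ (s' k hk)) (fun i hi j hj => G2.inj hi hj)
      (fun i hi j hj => G2'.inj hi hj) (code_det h2 h2')
  have surj : ∀ i < N, ∃ k < N, σ k = i := by
    intro i hi
    have hb : Function.Injective (fun k : Fin N => (⟨σ k, s k k.2⟩ : Fin N)) := by
      intro a b e
      simp only [Fin.mk.injEq] at e
      exact Fin.ext (G1.inj a.2 b.2 e)
    obtain ⟨k, hk⟩ := (Finite.injective_iff_surjective.1 hb) ⟨i, hi⟩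
    exact ⟨k, k.2, by simpa using hk⟩
  have ev : p.vals = p'.vals := by
    apply List.ext_getElem (by omega)
    intro i hi hi'
    rw [← valAt_eq hi, ← valAt_eq hi']
    obtain ⟨k, hk, rfl⟩ := surj i (by omega)
    rw [e2 k hk, e1 k hk]
  have eo : p.origin = p'.origin := by rw [← s0, ← s0', e1 0 hN0]
  cases p; cases p'; simp only [CPerm.mk.injEq] at *; exact ⟨ev, eo⟩

lemma count_bound {S : Set CPerm} (hd : ∀ p ∈ S, p.DrawnN) (n : ℕ) :
    {p | p ∈ S ∧ p.len = n}.Finite ∧ count S n ≤ 16 ^ (n + 1) := by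
  have : ∀ p : CPerm, ∃ F : (Fin (n + 1) → (Bool × Bool)) × (Fin (n + 1) → (Bool × Bool)),
      p ∈ S ∧ p.len = n → ∃ σ : ℕ → ℕ, (∀ k < n + 1, σ k < n + 1) ∧ σ 0 = p.origin ∧
        (∀ k : Fin (n + 1), GoodAt σ k (F.1 k)) ∧
        (∀ k : Fin (n + 1), GoodAt (fun k => p.valAt (σ k)) k (F.2 k)) := by
    intro p
    by_cases hp : p ∈ S ∧ p.len = n
    · obtain ⟨h0, pv, σ, s, s0, g1, g2⟩ := hd p hp.1
      have hl : p.vals.length = n + 1 := by have := hp.2; unfold len at this; omega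
      rw [hl] at s g1 g2
      choose b hb using g1
      choose c hc using g2
      exact ⟨(fun k => b k k.2, fun k => c k k.2), fun _ =>
        ⟨σ, s, s0, fun k => hb k k.2, fun k => hc k k.2⟩⟩
    · exact ⟨(fun _ => (true, true), fun _ => (true, true)), fun h => absurd h hp⟩
  choose F hF using this
  have inj : Set.InjOn F {p | p ∈ S ∧ p.len = n} := by
    intro p hp p' hp' e
    obtain ⟨σ, s, s0, h1, h2⟩ := hF p hp
    obtain ⟨σ', s', s0', h1', h2'⟩ := hF p' hp'
    obtain ⟨q0, pv, -⟩ := hd p hp.1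
    obtain ⟨q0', pv', -⟩ := hd p' hp'.1
    have hl : p.vals.length = n + 1 := by have := hp.2; unfold len at this; omega
    have hl' : p'.vals.length = n + 1 := by have := hp'.2; unfold len at this; omega
    rw [hl] at pv
    rw [hl'] at pv'
    rw [← e] at h1' h2'
    refine drawn_ext (b := fun k => if h : k < n + 1 then (F p).1 ⟨k, h⟩ else (true, true))
      (c := fun k => if h : k < n + 1 then (F p).2 ⟨k, h⟩ else (true, true))
      hl hl' (by omega) pv pv' s s' s0 s0' ?_ ?_ ?_ ?_
    all_goals
      intro k hk
      simp only [dif_pos hk]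
    · exact h1 ⟨k, hk⟩
    · exact h1' ⟨k, hk⟩
    · exact h2 ⟨k, hk⟩
    · exact h2' ⟨k, hk⟩
  refine ⟨Set.Finite.of_injOn (Set.mapsTo_univ _ _) inj Set.finite_univ, ?_⟩
  have := Set.ncard_le_ncard_of_injOn F (fun a _ => Set.mem_univ _) inj Set.finite_univ
  rw [Set.ncard_univ, Nat.card_eq_fintype_card] at this
  refine this.trans (le_of_eq ?_)
  simp
  rw [← mul_pow]
  norm_num

end CPerm

namespace CPerm

/-- `P` sits inside `π` as a contiguous block at position `c` and height `v`. -/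
def Blk (π : CPerm) (c v : ℕ) (P : CPerm) : Prop :=
  c + P.vals.length ≤ π.vals.length ∧ ∀ j < P.vals.length, π.valAt (c + j) = P.valAt j + v

lemma Blk.trans {π P R : CPerm} {c v c' v' : ℕ} (h : Blk π c v P) (h' : Blk P c' v' R) :
    Blk π (c + c') (v + v') R := by
  refine ⟨by have := h.1; have := h'.1; omega, fun j hj => ?_⟩
  have h1 := h'.1
  rw [add_assoc, h.2 _ (by omega), h'.2 j hj]; omega

lemma blk_box {p q : CPerm} (hq : q.origin < q.vals.length) :
    Blk (boxSum p q) q.origin q.originVal p := by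
  refine ⟨by have := boxSum_length (p := p) hq; omega, fun j hj => boxSum_valAt_block hq hj⟩

lemma Blk.int {π P : CPerm} {c v : ℕ} (h : Blk π c v P) (hπ : π.IsValid) (hP : P.IsValid)
    {i : ℕ} (hi : i < π.vals.length) :
    (c ≤ i ∧ i < c + P.vals.length) ↔ (v ≤ π.valAt i ∧ π.valAt i < v + P.vals.length) := by
  have h1 := h.1
  constructor
  · rintro ⟨a, b⟩
    obtain ⟨j, rfl⟩ := Nat.exists_eq_add_of_le a
    rw [h.2 j (by omega)]
    have := valid_lt hP (i := j) (by omega)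
    omega
  · rintro ⟨a, b⟩
    obtain ⟨j, hj, e⟩ := valid_surj hP (u := π.valAt i - v) (by omega)
    have := h.2 j hj
    have := valid_inj hπ hi (show c + j < π.vals.length by omega) (by omega)
    omega

lemma Blk.same {π P P' : CPerm} {c v v' : ℕ} (h : Blk π c v P) (h' : Blk π c v' P')
    (hP : P.IsValid) (hP' : P'.IsValid) (hl : P.vals.length = P'.vals.length) : v = v' := by
  obtain ⟨j, hj, e⟩ := valid_surj hP (valid_pos hP)
  obtain ⟨j', hj', e'⟩ := valid_surj hP' (valid_pos hP')
  have := h.2 j hj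
  have := h.2 j' (by omega)
  have := h'.2 j' hj'
  have := h'.2 j (by omega)
  omega

/-- the four extra points -/
lemma mu_box {a : ℕ} (ha : 1 ≤ a ∧ a ≤ 4) (p : CPerm) (hp : 0 < p.vals.length) :
    (mu a).origin ≤ 1 ∧ (mu a).originVal ≤ 1 ∧ (mu a).vals.length = 2 ∧
    (boxSum p (mu a)).valAt ((1 - (mu a).origin) * p.vals.length)
      = (1 - (mu a).originVal) * p.vals.length := by
  obtain ⟨h1, h2⟩ := ha
  have key := fun hne => boxSum_valAt_out (p := p) (q := mu a) (i := 1 - (mu a).origin) hp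
    (by interval_cases a <;> simp [mu]) (by interval_cases a <;> simp [mu]) hne
  refine ⟨?_, ?_, ?_, ?_⟩
  · interval_cases a <;> simp [mu]
  · interval_cases a <;> simp [mu, originVal, valAt]
  · interval_cases a <;> simp [mu]
  · have := key (by interval_cases a <;> simp [mu])
    have e : 1 + (p.vals.length - 1) = p.vals.length := by omega
    interval_cases a <;> simpa [mu, originVal, valAt, sh, e] using this

lemma adj_core {f : ℕ → ℕ} {n s c v c1 v1 c2 v2 c' v' c1' v1' c2' v2' oa wa ob wb o : ℕ}
    (inj : ∀ i < n, ∀ j < n, f i = f j → i = j)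
    (I : ∀ i < n, (c ≤ i ∧ i < c + s) ↔ (v ≤ f i ∧ f i < v + s))
    (I' : ∀ i < n, (c' ≤ i ∧ i < c' + s) ↔ (v' ≤ f i ∧ f i < v' + s))
    (ho : c ≤ o ∧ o < c + s) (ho' : c' ≤ o ∧ o < c' + s) (hon : o < n)
    (hc1 : c = c1 + oa) (hv1 : v = v1 + wa) (hc2 : c1 = c2 + ob) (hv2 : v1 = v2 + wb)
    (hc1' : c' = c1' + oa) (hv1' : v' = v1' + wa) (hc2' : c1' = c2' + ob) (hv2' : v1' = v2' + wb)
    (hn : c2 + s + 2 ≤ n) (hn' : c2' + s + 2 ≤ n)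
    (A : f (c1 + (1 - oa) * s) = v1 + (1 - wa) * s)
    (B : f (c2 + (1 - ob) * (s + 1)) = v2 + (1 - wb) * (s + 1))
    (A' : f (c1' + (1 - oa) * s) = v1' + (1 - wa) * s)
    (B' : f (c2' + (1 - ob) * (s + 1)) = v2' + (1 - wb) * (s + 1))
    (h : (oa ≤ 1 ∧ wa ≤ 1) ∧ (ob ≤ 1 ∧ wb ≤ 1) ∧
      ((oa = ob ∧ wa ≠ wb) ∨ (oa ≠ ob ∧ wa = wb)))
    (hne : v = v' → c = c') (hne' : c = c' → v = v') : c = c' := by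
  by_contra hcc
  have hvv : v ≠ v' := fun h => hcc (hne h)
  have J := (I o hon).1 ho
  have J' := (I' o hon).1 ho'
  obtain ⟨⟨h1, h2⟩, ⟨h3, h4⟩, h5⟩ := h
  have IA := I (c1' + (1 - oa) * s)
  have IB := I (c2' + (1 - ob) * (s + 1))
  have IA' := I' (c1 + (1 - oa) * s)
  have IB' := I' (c2 + (1 - ob) * (s + 1))
  have j1 := inj (c1' + (1 - oa) * s)
  have j1 := fun h => j1 h (c2 + (1 - ob) * (s + 1))
  have j2 := inj (c1 + (1 - oa) * s)
  have j2 := fun h => j2 h (c2' + (1 - ob) * (s + 1))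
  rw [A, B'] at j2
  rw [A', B] at j1
  rw [A'] at IA
  rw [B'] at IB
  rw [A] at IA'
  rw [B] at IB'
  have k1 := congrArg (fun i => f i) (rfl : c1 = c1)
  have e1 : c2 + (1 - ob) * (s + 1) = c1' + (1 - oa) * s →
      v2 + (1 - wb) * (s + 1) = v1' + (1 - wa) * s := fun h => by rw [← A', ← B, h]
  have e2 : c2' + (1 - ob) * (s + 1) = c1 + (1 - oa) * s →
      v2' + (1 - wb) * (s + 1) = v1 + (1 - wa) * s := fun h => by rw [← A, ← B', h]
  clear k1 A B A' B' I I' inj hne hne'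
  subst hc1 hv1 hc1' hv1' hc2 hv2 hc2' hv2'
  interval_cases oa <;> interval_cases wa <;> interval_cases ob <;> interval_cases wb <;>
    first
    | (exfalso; omega)
    | (simp only [Nat.sub_self, Nat.sub_zero, zero_mul, one_mul, add_zero] at *
       clear h5; omega)

lemma mu_facts {a b : ℕ} (h : AdjacentQuadrants a b) : (1 ≤ a ∧ a ≤ 4) ∧ (1 ≤ b ∧ b ≤ 4) ∧
    (((mu a).origin = (mu b).origin ∧ (mu a).originVal ≠ (mu b).originVal) ∨
      ((mu a).origin ≠ (mu b).origin ∧ (mu a).originVal = (mu b).originVal)) := by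
  unfold AdjacentQuadrants at h
  simp only [Prod.mk.injEq] at h
  rcases h with ⟨rfl, rfl⟩ | ⟨rfl, rfl⟩ | ⟨rfl, rfl⟩ | ⟨rfl, rfl⟩ | ⟨rfl, rfl⟩ | ⟨rfl, rfl⟩ |
    ⟨rfl, rfl⟩ | ⟨rfl, rfl⟩ <;> simp [mu, originVal, valAt]

lemma adj_inj {S : Set CPerm} (hS : IsClass S) (hbox : BoxClosed S) {a b : ℕ}
    (hab : AdjacentQuadrants a b) (ha : mu a ∈ S) (hb : mu b ∈ S) {p q p' q' : CPerm}
    (hp : p ∈ S) (hq : q ∈ S) (hp' : p' ∈ S) (hq' : q' ∈ S)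
    (hl : p.vals.length = p'.vals.length)
    (h : boxSum (boxSum (boxSum p (mu a)) (mu b)) q
      = boxSum (boxSum (boxSum p' (mu a)) (mu b)) q') : p = p' ∧ q = q' := by
  obtain ⟨ra, rb, hadj⟩ := mu_facts hab
  have V := hS.2.1
  have hY := hbox p hp _ ha
  have hX := hbox _ hY _ hb
  have hπ := hbox _ hX q hq
  have hY' := hbox p' hp' _ ha
  have hX' := hbox _ hY' _ hb
  have oa := (V _ ha).2.1
  have ob := (V _ hb).2.1
  have oq := (V _ hq).2.1
  have oq' := (V _ hq').2.1
  obtain ⟨a1, a2, a3, pA⟩ := mu_box ra p (valid_pos (V _ hp))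
  obtain ⟨-, -, -, pA'⟩ := mu_box ra p' (valid_pos (V _ hp'))
  obtain ⟨b1, b2, b3, pB⟩ := mu_box rb (boxSum p (mu a)) (valid_pos (V _ hY))
  obtain ⟨-, -, -, pB'⟩ := mu_box rb (boxSum p' (mu a)) (valid_pos (V _ hY'))
  have lY := boxSum_length (p := p) oa
  have lY' := boxSum_length (p := p') oa
  have lX := boxSum_length (p := boxSum p (mu a)) ob
  have lX' := boxSum_length (p := boxSum p' (mu a)) ob
  have kX := blk_box (p := boxSum (boxSum p (mu a)) (mu b)) oq
  have kX' := blk_box (p := boxSum (boxSum p' (mu a)) (mu b)) oq'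
  rw [← h] at kX'
  have kY := kX.trans (blk_box (p := boxSum p (mu a)) ob)
  have kY' := kX'.trans (blk_box (p := boxSum p' (mu a)) ob)
  have kp := kY.trans (blk_box (p := p) oa)
  have kp' := kY'.trans (blk_box (p := p') oa)
  have eo : (boxSum (boxSum (boxSum p (mu a)) (mu b)) q).origin
      = q.origin + (mu b).origin + (mu a).origin + p.origin := by
    simp only [boxSum_origin]; omega
  have eo' : (boxSum (boxSum (boxSum p (mu a)) (mu b)) q).origin
      = q'.origin + (mu b).origin + (mu a).origin + p'.origin := by
    rw [h]; simp only [boxSum_origin]; omega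
  have onn := (V _ hπ).2.1
  have op := (V _ hp).2.1
  have op' := (V _ hp').2.1
  generalize hππ : boxSum (boxSum (boxSum p (mu a)) (mu b)) q = π at *
  have Vπ := V _ hπ
  have lYs : (boxSum p (mu a)).vals.length = p.vals.length + 1 := by omega
  have lYs' : (boxSum p' (mu a)).vals.length = p.vals.length + 1 := by omega
  have m1 : (1 - (mu a).origin) * p.vals.length ≤ p.vals.length := by
    calc _ ≤ 1 * p.vals.length := Nat.mul_le_mul_right _ (by omega)
      _ = _ := one_mul _
  have m2 : (1 - (mu b).origin) * (p.vals.length + 1) ≤ p.vals.length + 1 := by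
    calc _ ≤ 1 * (p.vals.length + 1) := Nat.mul_le_mul_right _ (by omega)
      _ = _ := one_mul _
  rw [lYs] at pB
  rw [lYs'] at pB'
  rw [← hl] at pA'
  have fA := kY.2 _ (show (1 - (mu a).origin) * p.vals.length < _ by omega)
  have fA' := kY'.2 _ (show (1 - (mu a).origin) * p.vals.length < _ by omega)
  have fB := kX.2 _ (show (1 - (mu b).origin) * (p.vals.length + 1) < _ by omega)
  have fB' := kX'.2 _ (show (1 - (mu b).origin) * (p.vals.length + 1) < _ by omega)
  rw [pA, add_comm _ (q.originVal + _)] at fA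
  rw [pA', add_comm _ (q'.originVal + _)] at fA'
  rw [pB, add_comm _ q.originVal] at fB
  rw [pB', add_comm _ q'.originVal] at fB'
  have hcv : q.origin + (mu b).origin + (mu a).origin = q'.origin + (mu b).origin + (mu a).origin →
      q.originVal + (mu b).originVal + (mu a).originVal
        = q'.originVal + (mu b).originVal + (mu a).originVal := by
    intro e
    rw [← e] at kp'
    exact kp.same kp' (V _ hp) (V _ hp') hl
  have hvc : q.originVal + (mu b).originVal + (mu a).originVal
        = q'.originVal + (mu b).originVal + (mu a).originVal →
      q.origin + (mu b).origin + (mu a).origin = q'.origin + (mu b).origin + (mu a).origin := by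
    intro e
    have pos := valid_pos (V _ hp)
    have z1 := kp.1
    have z2 := kp'.1
    have i1 := kp.int Vπ (V _ hp)
      (i := q'.origin + (mu b).origin + (mu a).origin) (by omega)
    have i2 := kp'.int Vπ (V _ hp')
      (i := q'.origin + (mu b).origin + (mu a).origin) (by omega)
    have i3 := kp.int Vπ (V _ hp)
      (i := q.origin + (mu b).origin + (mu a).origin) (by omega)
    have i4 := kp'.int Vπ (V _ hp')
      (i := q.origin + (mu b).origin + (mu a).origin) (by omega)
    omega
  have hc := adj_core (f := π.valAt) (n := π.vals.length) (s := p.vals.length) (o := π.origin)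
    (fun i hi j hj => valid_inj Vπ hi hj)
    (fun i hi => kp.int Vπ (V _ hp) hi)
    (fun i hi => by rw [hl]; exact kp'.int Vπ (V _ hp') hi)
    (by omega) (by omega) onn rfl rfl rfl rfl rfl rfl rfl rfl
    (by have := kX.1; omega) (by have := kX'.1; omega) fA fB fA' fB'
    ⟨⟨a1, a2⟩, ⟨b1, b2⟩, hadj⟩ hvc hcv
  have hv := hcv hc
  rw [← hππ] at h
  obtain ⟨e1, e2⟩ := boxSum_cancel oq oq' (by omega) h (by omega) (by omega)
  obtain ⟨e1, -⟩ := boxSum_cancel ob ob (by omega) e1 rfl rfl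
  obtain ⟨e1, -⟩ := boxSum_cancel oa oa (by omega) e1 rfl rfl
  exact ⟨e1, e2⟩

lemma mu_valid {a : ℕ} (ha : 1 ≤ a ∧ a ≤ 4) : (mu a).IsValid := by
  obtain ⟨h1, h2⟩ := ha
  interval_cases a <;> refine ⟨by simp [mu], by simp [mu], ?_⟩ <;> simp [mu] <;> decide

lemma mu_pattern {S : Set CPerm} (hS : IsClass S) {π : CPerm} (hπ : π ∈ S) {i : ℕ}
    (hi : i < π.vals.length) :
    (i < π.origin → mu 2 ∈ S ∨ mu 3 ∈ S) ∧ (π.origin < i → mu 1 ∈ S ∨ mu 4 ∈ S) := by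
  have Vπ := hS.2.1 _ hπ
  have o := Vπ.2.1
  have ne : i ≠ π.origin → π.valAt i ≠ π.valAt π.origin := fun h e => h (valid_inj Vπ hi o e)
  constructor
  · intro h
    rcases lt_or_gt_of_ne (ne (by omega)) with h' | h'
    · right
      refine hS.2.2 _ _ hπ (mu_valid (by omega)) ⟨fun k => if k = 0 then i else π.origin, ?_, ?_, ?_, ?_⟩
      · intro k j hk hj hkj; simp [mu] at hk hj; interval_cases k <;> interval_cases j <;> simp_all
      · intro k hk; simp [mu] at hk; interval_cases k <;> simp_all
      · simp [mu]
      · intro k j hk hj; simp [mu] at hk hj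
        interval_cases k <;> interval_cases j <;> simp [mu, valAt] at * <;> omega
    · left
      refine hS.2.2 _ _ hπ (mu_valid (by omega)) ⟨fun k => if k = 0 then i else π.origin, ?_, ?_, ?_, ?_⟩
      · intro k j hk hj hkj; simp [mu] at hk hj; interval_cases k <;> interval_cases j <;> simp_all
      · intro k hk; simp [mu] at hk; interval_cases k <;> simp_all
      · simp [mu]
      · intro k j hk hj; simp [mu] at hk hj
        interval_cases k <;> interval_cases j <;> simp [mu, valAt] at * <;> omega
  · intro h
    rcases lt_or_gt_of_ne (ne (by omega)) with h' | h'
    · right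
      refine hS.2.2 _ _ hπ (mu_valid (by omega)) ⟨fun k => if k = 0 then π.origin else i, ?_, ?_, ?_, ?_⟩
      · intro k j hk hj hkj; simp [mu] at hk hj; interval_cases k <;> interval_cases j <;> simp_all
      · intro k hk; simp [mu] at hk; interval_cases k <;> simp_all
      · simp [mu]
      · intro k j hk hj; simp [mu] at hk hj
        interval_cases k <;> interval_cases j <;> simp [mu, valAt] at * <;> omega
    · left
      refine hS.2.2 _ _ hπ (mu_valid (by omega)) ⟨fun k => if k = 0 then π.origin else i, ?_, ?_, ?_, ?_⟩
      · intro k j hk hj hkj; simp [mu] at hk hj; interval_cases k <;> interval_cases j <;> simp_all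
      · intro k hk; simp [mu] at hk; interval_cases k <;> simp_all
      · simp [mu]
      · intro k j hk hj; simp [mu] at hk hj
        interval_cases k <;> interval_cases j <;> simp [mu, valAt] at * <;> omega

lemma one_inj {S : Set CPerm} (hS : IsClass S) (hbox : BoxClosed S)
    (hone : ∃! q : ℕ, q ∈ ({1, 2, 3, 4} : Set ℕ) ∧ mu q ∈ S) {p q p' q' : CPerm}
    (hp : p ∈ S) (hq : q ∈ S) (hp' : p' ∈ S) (hq' : q' ∈ S)
    (hl : p.vals.length = p'.vals.length)
    (h : boxSum p q = boxSum p' q') : p = p' ∧ q = q' := by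
  have V := hS.2.1
  have hπ := hbox p hp q hq
  have oq := (V _ hq).2.1
  have oq' := (V _ hq').2.1
  have op := (V _ hp).2.1
  have op' := (V _ hp').2.1
  have k := blk_box (p := p) oq
  have k' := blk_box (p := p') oq'
  have eo : (boxSum p q).origin = q.origin + p.origin := rfl
  have eo' : (boxSum p q).origin = q'.origin + p'.origin := by rw [h]; rfl
  rw [← h] at k'
  have nolr : ∀ i j, i < (boxSum p q).vals.length → j < (boxSum p q).vals.length →
      i < (boxSum p q).origin → (boxSum p q).origin < j → False := by
    intro i j hi hj h1 h2
    have a1 := (mu_pattern hS hπ hi).1 h1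
    have a2 := (mu_pattern hS hπ hj).2 h2
    rcases a1 with a1 | a1 <;> rcases a2 with a2 | a2 <;>
    · have := hone.unique ⟨by simp, a1⟩ ⟨by simp, a2⟩
      omega
  have k1 := k.1
  have k1' := k'.1
  have hc : q.origin = q'.origin := by
    by_contra hne
    rcases lt_or_gt_of_ne hne with h' | h'
    · exact nolr q.origin (q'.origin + p'.vals.length - 1) (by omega) (by omega) (by omega)
        (by omega)
    · exact nolr q'.origin (q.origin + p.vals.length - 1) (by omega) (by omega) (by omega)
        (by omega)
  have hv : q.originVal = q'.originVal := by
    rw [← hc] at k'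
    exact k.same k' (V _ hp) (V _ hp') hl
  exact boxSum_cancel oq oq' hl h hc hv

lemma len_boxSum {p q : CPerm} (hp : p.IsValid) (hq : q.IsValid) :
    (boxSum p q).len = p.len + q.len := by
  have := boxSum_length (p := p) hq.2.1
  have := valid_pos hp
  have := valid_pos hq
  unfold len; omega

lemma len_mu {a : ℕ} (ha : 1 ≤ a ∧ a ≤ 4) : (mu a).len = 1 := by
  obtain ⟨h1, h2⟩ := ha
  interval_cases a <;> simp [mu, len]

lemma length_of_len {p : CPerm} (hp : p.IsValid) : p.vals.length = p.len + 1 := by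
  have := valid_pos hp
  unfold len; omega

lemma count_mono {S : Set CPerm} (hS : IsClass S) (hbox : BoxClosed S)
    (fin : ∀ n, {p | p ∈ S ∧ p.len = n}.Finite) {a : ℕ} (ra : 1 ≤ a ∧ a ≤ 4) (ha : mu a ∈ S) :
    Monotone (count S) := by
  refine monotone_nat_of_le_succ fun n => ?_
  have V := hS.2.1
  refine Set.ncard_le_ncard_of_injOn (fun p => boxSum p (mu a)) ?_ ?_ (fin _)
  · rintro p ⟨hp, rfl⟩
    exact ⟨hbox _ hp _ ha, by rw [len_boxSum (V _ hp) (V _ ha), len_mu ra]⟩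
  · rintro p ⟨hp, e⟩ p' ⟨hp', e'⟩ h
    have o := (V _ ha).2.1
    exact (boxSum_cancel o o (by rw [length_of_len (V _ hp), length_of_len (V _ hp'), e, e'])
      h rfl rfl).1

lemma count_mul {S : Set CPerm} (fin : ∀ n, {p | p ∈ S ∧ p.len = n}.Finite) (k m n : ℕ)
    (Φ : CPerm → CPerm → CPerm)
    (h1 : ∀ p ∈ S, ∀ q ∈ S, Φ p q ∈ S ∧ (Φ p q).len = p.len + q.len + k)
    (h2 : ∀ p ∈ S, ∀ q ∈ S, ∀ p' ∈ S, ∀ q' ∈ S, p.len = p'.len → Φ p q = Φ p' q' →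
      p = p' ∧ q = q') :
    count S m * count S n ≤ count S (m + n + k) := by
  unfold count
  rw [← Set.ncard_prod]
  refine Set.ncard_le_ncard_of_injOn (fun x => Φ x.1 x.2) ?_ ?_ (fin _)
  · rintro ⟨p, q⟩ ⟨⟨hp, rfl⟩, ⟨hq, rfl⟩⟩
    exact h1 p hp q hq
  · rintro ⟨p, q⟩ ⟨⟨hp, e1⟩, ⟨hq, e2⟩⟩ ⟨p', q'⟩ ⟨⟨hp', e1'⟩, ⟨hq', e2'⟩⟩ h
    obtain ⟨r1, r2⟩ := h2 p hp q hq p' hp' q' hq' (by simp only at *; omega) h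
    rw [r1, r2]

lemma count_zero {S : Set CPerm} (hS : IsClass S) : count S 0 = 1 := by
  unfold count
  rw [Set.ncard_eq_one]
  have key : ∀ p : CPerm, p.IsValid → p.len = 0 → p = trivial := by
    intro p hp h
    have hl := length_of_len hp
    have ho := hp.2.1
    have hperm := hp.2.2
    rw [h] at hl
    rw [hl] at hperm ho
    have : p.vals = [0] := by simpa using hperm
    cases p; simp only [trivial, CPerm.mk.injEq] at *; exact ⟨this, by omega⟩
  refine ⟨trivial, Set.eq_singleton_iff_unique_mem.2 ⟨⟨?_, rfl⟩, fun p hp => key p (hS.2.1 _ hp.1) hp.2⟩⟩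
  obtain ⟨p, hp⟩ := hS.1
  have Vp := hS.2.1 _ hp
  refine hS.2.2 _ _ hp ⟨by simp [trivial], by simp [trivial], by simp [trivial]⟩
    ⟨fun _ => p.origin, ?_, ?_, rfl, ?_⟩
  · intro i j hi hj hij; simp [trivial] at hi hj; omega
  · intro i _; exact Vp.2.1
  · intro i j hi hj; simp [trivial] at hi hj; subst hi hj; simp

end CPerm

/-- Fekete's lemma with a shift -/
lemma fekete_shift (C : ℕ → ℕ) (h0 : C 0 = 1) (hm : Monotone C)
    (hmul : ∀ m n, C m * C n ≤ C (m + n + 2)) (hb : ∀ n, C n ≤ 16 ^ (n + 1)) :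
    ∃ L : ℝ, Tendsto (fun n : ℕ => ((C n : ℝ)) ^ ((n : ℝ)⁻¹)) atTop (nhds L) := by
  have pos : ∀ n, 1 ≤ C n := fun n => h0 ▸ hm (Nat.zero_le n)
  have posR : ∀ n, (0 : ℝ) < C n := fun n => by exact_mod_cast pos n
  let u : ℕ → ℝ := fun n => -Real.log (C (n - 2))
  have hle : ∀ m n, C (m - 2) * C (n - 2) ≤ C (m + n - 2) := by
    intro m n
    by_cases h1 : m ≤ 2
    · rw [show m - 2 = 0 by omega, h0, one_mul]; exact hm (by omega)
    by_cases h2 : n ≤ 2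
    · rw [show n - 2 = 0 by omega, h0, mul_one]; exact hm (by omega)
    have := hmul (m - 2) (n - 2)
    rwa [show m - 2 + (n - 2) + 2 = m + n - 2 by omega] at this
  have hu : Subadditive u := by
    intro m n
    simp only [u]
    have : Real.log (C (m - 2)) + Real.log (C (n - 2)) ≤ Real.log (C (m + n - 2)) := by
      rw [← Real.log_mul (posR _).ne' (posR _).ne']
      exact Real.log_le_log (mul_pos (posR _) (posR _)) (by exact_mod_cast hle m n)
    linarith
  have hbdd : BddBelow (Set.range fun n => u n / n) := by
    refine ⟨-(2 * Real.log 16), ?_⟩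
    rintro _ ⟨n, rfl⟩
    have l16 : 0 < Real.log 16 := Real.log_pos (by norm_num)
    rcases Nat.eq_zero_or_pos n with rfl | hn
    · simp; linarith
    · have hn' : (1 : ℝ) ≤ n := by exact_mod_cast hn
      simp only [u]
      rw [le_div_iff₀ (by linarith)]
      have h1 : Real.log (C (n - 2)) ≤ (2 * n : ℕ) * Real.log 16 := by
        rw [← Real.log_pow]
        refine Real.log_le_log (posR _) ?_
        have : C (n - 2) ≤ 16 ^ (2 * n) :=
          (hb _).trans (Nat.pow_le_pow_right (by norm_num) (by omega))
        exact_mod_cast this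
      push_cast at h1
      linarith
  have ht := hu.tendsto_lim hbdd
  have ht2 := ht.comp (tendsto_add_atTop_nat 2)
  have hr : Tendsto (fun n : ℕ => ((n : ℝ) + 2) / n) atTop (nhds 1) := by
    have h : Tendsto (fun n : ℕ => 1 + 2 * ((n : ℝ))⁻¹) atTop (nhds (1 + 2 * 0)) :=
      (tendsto_inv_atTop_nhds_zero_nat (𝕜 := ℝ)).const_mul 2 |>.const_add 1
    rw [mul_zero, add_zero] at h
    refine h.congr' ?_
    filter_upwards [eventually_gt_atTop 0] with n hn
    have : (n : ℝ) ≠ 0 := by positivity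
    field_simp
  refine ⟨Real.exp (-(hu.lim * 1)), ?_⟩
  have hfin := (Real.continuous_exp.tendsto _).comp (ht2.mul hr).neg
  refine hfin.congr' ?_
  filter_upwards [eventually_gt_atTop 0] with n hn
  have hn' : (n : ℝ) ≠ 0 := by positivity
  have hn2 : (n : ℝ) + 2 ≠ 0 := by positivity
  simp only [Function.comp, u]
  rw [Real.rpow_def_of_pos (posR n)]
  congr 1
  simp only [Nat.add_sub_cancel]
  push_cast
  field_simp

/-- Every ⊞-closed subclass of the complete pin class
satisfying the adjacency condition has a proper growth rate. -/
theorem box_closed_pin_subclass_growth_rate (S : Set CPerm) (hS : CPerm.IsClass S)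
    (hbox : CPerm.BoxClosed S) (hsub : S ⊆ CompletePinClass)
    (hadj : CPerm.AdjacencyCondition S) :
    ∃ L : ℝ, Tendsto (fun n : ℕ => ((CPerm.count S n : ℝ)) ^ ((n : ℝ)⁻¹)) atTop
      (nhds L) := by
  have hd : ∀ p ∈ S, p.DrawnN := fun p hp => complete_drawn (hsub hp)
  have fin : ∀ n, {p | p ∈ S ∧ p.len = n}.Finite := fun n => (CPerm.count_bound hd n).1
  have V := hS.2.1
  have main : Monotone (CPerm.count S) ∧
      ∀ m n, CPerm.count S m * CPerm.count S n ≤ CPerm.count S (m + n + 2) := by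
    rcases hadj with hone | ⟨a, b, hab, ha, hb⟩
    · obtain ⟨q, hq, hqS⟩ := hone.exists
      have rq : 1 ≤ q ∧ q ≤ 4 := by
        simp only [Set.mem_insert_iff, Set.mem_singleton_iff] at hq
        omega
      have mono := CPerm.count_mono hS hbox fin rq hqS
      refine ⟨mono, fun m n => ?_⟩
      refine le_trans ?_ (mono (show m + n + 0 ≤ m + n + 2 by omega))
      refine CPerm.count_mul fin 0 m n CPerm.boxSum ?_ ?_
      · intro p hp q hq
        exact ⟨hbox p hp q hq, CPerm.len_boxSum (V _ hp) (V _ hq)⟩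
      · intro p hp q hq p' hp' q' hq' hl h
        exact CPerm.one_inj hS hbox hone hp hq hp' hq'
          (by rw [CPerm.length_of_len (V _ hp), CPerm.length_of_len (V _ hp'), hl]) h
    · obtain ⟨ra, rb, -⟩ := CPerm.mu_facts hab
      refine ⟨CPerm.count_mono hS hbox fin ra ha, fun m n => ?_⟩
      refine CPerm.count_mul fin 2 m n (fun p q =>
        CPerm.boxSum (CPerm.boxSum (CPerm.boxSum p (CPerm.mu a)) (CPerm.mu b)) q) ?_ ?_
      · intro p hp q hq
        have hY := hbox p hp _ ha
        have hX := hbox _ hY _ hb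
        refine ⟨hbox _ hX q hq, ?_⟩
        rw [CPerm.len_boxSum (V _ hX) (V _ hq), CPerm.len_boxSum (V _ hY) (V _ hb),
          CPerm.len_boxSum (V _ hp) (V _ ha), CPerm.len_mu ra, CPerm.len_mu rb]
        omega
      · intro p hp q hq p' hp' q' hq' hl h
        exact CPerm.adj_inj hS hbox hab ha hb hp hq hp' hq'
          (by rw [CPerm.length_of_len (V _ hp), CPerm.length_of_len (V _ hp'), hl]) h
  exact fekete_shift _ (CPerm.count_zero hS) main.1 main.2
    (fun n => (CPerm.count_bound hd n).2)
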